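/- Let K be a locally κ-presentable category and X a set of morphisms between κ-presentable objects. Then the class of transfinite composites of length < κ of pushouts of morphisms from X equals the class of pushouts of transfinite composites of length < κ of pushouts of morphisms from X between κ-presentable objects. (Symbolically: Tc_{<κ} Po(X) = Po Tc_{<κ} Po_κ(X).) -/

import Mathlib

open CategoryTheory Category Limits Opposite

universe w v u u' u''

namespace CellularPaper

variable {K : Type u} [Category.{v} K]

/-- The restriction of a chain `F : J ⥤ K` to the elements below `j`. -/
def restrictionLT {J : Type w} [Preorder J] (F : J ⥤ K) (j : J) :
    {i : J // i < j} ⥤ K :=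
  (Monotone.functor (f := fun i : {i : J // i < j} => (i : J)) fun _ _ h => h) ⋙ F

/-- The cocone on the restriction of `F` below `j` with apex `F.obj j`. -/
@[simps]
def coconeLT {J : Type w} [Preorder J] (F : J ⥤ K) (j : J) :
    Cocone (restrictionLT F j) where
  pt := F.obj j
  ι :=
    { app := fun i => F.map (homOfLE i.2.le)
      naturality := fun i i' h => by
        dsimp [restrictionLT, Monotone.functor]
        rw [← F.map_comp]
        simp }

/-- `f` is a transfinite composite of a smooth chain with links in `C`. -/
def IsTransfiniteCompositionOf (C : MorphismProperty K) : MorphismProperty K :=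
  fun A B f =>
    ∃ (J : Type w) (_ : LinearOrder J) (_ : SuccOrder J) (_ : OrderBot J)
      (_ : WellFoundedLT J) (F : J ⥤ K) (c : Cocone F) (_ : IsColimit c)
      (eA : A ≅ F.obj ⊥) (eB : c.pt ≅ B),
      (∀ j : J, ¬IsMax j → C (F.map (homOfLE (Order.le_succ j)))) ∧
      (∀ j : J, Order.IsSuccLimit j → Nonempty (IsColimit (coconeLT F j))) ∧
      eA.hom ≫ c.ι.app ⊥ ≫ eB.hom = f

/-- A cellular structure: a class of morphisms containing all isomorphisms and closed
under pushout and transfinite composition. -/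
structure IsCellular (C : MorphismProperty K) : Prop where
  isos : ∀ {A B : K} (f : A ⟶ B), IsIso f → C f
  pushout : ∀ {A B A' B' : K} {f : A ⟶ B} {u : A ⟶ A'} {v : B ⟶ B'} {g : A' ⟶ B'},
    IsPushout f u v g → C f → C g
  transfinite : ∀ {A B : K} (f : A ⟶ B), IsTransfiniteCompositionOf.{v} C f → C f

/-- `f` is a retract of `g` in the arrow category. -/
def IsRetractOf {A B X Y : K} (f : A ⟶ B) (g : X ⟶ Y) : Prop :=
  ∃ (u : A ⟶ X) (v : B ⟶ Y) (r : X ⟶ A) (s : Y ⟶ B),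
    u ≫ g = f ≫ v ∧ r ≫ f = g ≫ s ∧ u ≫ r = 𝟙 A ∧ v ≫ s = 𝟙 B

/-- The class of retracts of morphisms in `C`. -/
def retracts (C : MorphismProperty K) : MorphismProperty K :=
  fun _ _ f => ∃ (X Y : K) (g : X ⟶ Y), C g ∧ IsRetractOf f g

/-- The class of pushouts of morphisms in `C`. -/
def Po (C : MorphismProperty K) : MorphismProperty K :=
  fun A' B' g => ∃ (A B : K) (f : A ⟶ B) (u : A ⟶ A') (v : B ⟶ B'),
    C f ∧ IsPushout f u v g

/-- A κ-directed preorder. -/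
def IsCardinalDirected (P : Type v) [Preorder P] (κ : Cardinal.{v}) : Prop :=
  ∀ S : Set P, Cardinal.mk S < κ → ∃ p : P, ∀ s ∈ S, s ≤ p

/-- A κ-presentable object: its hom-functor preserves κ-directed colimits. -/
def IsCardinalPresentable (κ : Cardinal.{v}) (A : K) : Prop :=
  ∀ (P : Type v) (_ : Preorder P), IsCardinalDirected P κ →
    Nonempty (PreservesColimitsOfShape P (coyoneda.obj (op A)))

/-- A locally κ-presentable category. -/
structure IsLocallyPresentable (κ : Cardinal.{v}) (K : Type u) [Category.{v} K] : Prop where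
  regular : κ.IsRegular
  hasColimits : HasColimits K
  generators : ∃ (ι : Type v) (G : ι → K), (∀ i, IsCardinalPresentable κ (G i)) ∧
    ∀ X : K, ∃ (P : Type v) (_ : Preorder P) (F : P ⥤ K) (c : Cocone F) (_ : IsColimit c),
      IsCardinalDirected P κ ∧ Nonempty (c.pt ≅ X) ∧ ∀ p : P, ∃ i, Nonempty (F.obj p ≅ G i)

/-- A locally presentable category. -/
def LocallyPresentable (K : Type u) [Category.{v} K] : Prop :=
  ∃ κ : Cardinal.{v}, IsLocallyPresentable κ K

/-- The smallest cellular class containing `X`. -/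
def cellClosure (X : MorphismProperty K) : MorphismProperty K :=
  fun _ _ f => ∀ C : MorphismProperty K, IsCellular C → X ≤ C → C f

/-- `cof(X)`: retracts of transfinite composites of pushouts of `X`. -/
def cofClosure (X : MorphismProperty K) : MorphismProperty K :=
  retracts (IsTransfiniteCompositionOf.{v} (Po X))

/-- The morphism property generated by a family of morphisms. -/
def ofFamily {ι : Type*} {a b : ι → K} (s : ∀ i, a i ⟶ b i) : MorphismProperty K :=
  fun _ _ f => ∃ i, Nonempty (Arrow.mk f ≅ Arrow.mk (s i))

/-- `C` is cofibrantly generated by a set of morphisms. -/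
def IsCofibrantlyGenerated (C : MorphismProperty K) : Prop :=
  ∃ (ι : Type v) (a b : ι → K) (s : ∀ i, a i ⟶ b i),
    C = cofClosure (ofFamily s)

/-- A combinatorial structure on a locally presentable category. -/
structure IsCombinatorial (K : Type u) [Category.{v} K] (C : MorphismProperty K) : Prop where
  locallyPresentable : LocallyPresentable K
  cellular : IsCellular C
  retractClosed : retracts C ≤ C
  cofibrantlyGenerated : IsCofibrantlyGenerated C

/-- `f` is a transfinite composite of length `< κ` of morphisms in `C`. -/
def IsBoundedTransfiniteCompositionOf (κ : Cardinal.{v}) (C : MorphismProperty K) :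
    MorphismProperty K :=
  fun A B f =>
    ∃ (J : Type v) (_ : LinearOrder J) (_ : SuccOrder J) (_ : OrderBot J)
      (_ : WellFoundedLT J), Cardinal.mk J < κ ∧
      ∃ (F : J ⥤ K) (c : Cocone F) (_ : IsColimit c)
        (eA : A ≅ F.obj ⊥) (eB : c.pt ≅ B),
        (∀ j : J, ¬IsMax j → C (F.map (homOfLE (Order.le_succ j)))) ∧
        (∀ j : J, Order.IsSuccLimit j → Nonempty (IsColimit (coconeLT F j))) ∧
        eA.hom ≫ c.ι.app ⊥ ≫ eB.hom = f

/-- The morphisms of `C` with κ-presentable domain and codomain. -/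
def betweenPresentable (κ : Cardinal.{v}) (C : MorphismProperty K) : MorphismProperty K :=
  fun A B f => C f ∧ IsCardinalPresentable κ A ∧ IsCardinalPresentable κ B

/-- `Po_κ(X)`: pushouts of morphisms of `X` between κ-presentable objects. -/
def PoCard (κ : Cardinal.{v}) (X : MorphismProperty K) : MorphismProperty K :=
  betweenPresentable κ (Po X)

/-- The category `psh(K²)`: objects are morphisms of `K`, morphisms are pushout squares. -/
structure PshArrow (K : Type u) [Category.{v} K] : Type max u v where
  arr : Arrow K

instance : Category.{v} (PshArrow K) where
  Hom g f := {φ : g.arr ⟶ f.arr // IsPushout g.arr.hom φ.left φ.right f.arr.hom}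
  id g := ⟨𝟙 _, IsPushout.of_vert_isIso ⟨by simp⟩⟩
  comp φ ψ := ⟨φ.1 ≫ ψ.1, φ.2.paste_vert ψ.2⟩
  id_comp φ := Subtype.ext (Category.id_comp _)
  comp_id φ := Subtype.ext (Category.comp_id _)
  assoc _ _ _ := Subtype.ext (Category.assoc _ _ _)


section PsPull

variable {K : Type u} {L : Type u'} {M : Type u''}
variable [Category.{v} K] [Category.{v} L] [Category.{v} M]

/-- The pseudopullback of `F : K ⥤ M` and `G : L ⥤ M`. -/
structure PsPull (F : K ⥤ M) (G : L ⥤ M) : Type max u u' v where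
  k : K
  l : L
  t : F.obj k ≅ G.obj l

variable {F : K ⥤ M} {G : L ⥤ M}

/-- Morphisms in the pseudopullback. -/
@[ext]
structure PsHom (a b : PsPull F G) : Type v where
  hk : a.k ⟶ b.k
  hl : a.l ⟶ b.l
  w : F.map hk ≫ b.t.hom = a.t.hom ≫ G.map hl

instance : Category.{v} (PsPull F G) where
  Hom := PsHom
  id a := ⟨𝟙 _, 𝟙 _, by simp⟩
  comp f g := ⟨f.hk ≫ g.hk, f.hl ≫ g.hl, by
    rw [F.map_comp, G.map_comp, Category.assoc, g.w, ← Category.assoc, f.w,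
      Category.assoc]⟩

/-- The first projection of the pseudopullback. -/
def projK (F : K ⥤ M) (G : L ⥤ M) : PsPull F G ⥤ K where
  obj a := a.k
  map f := f.hk

/-- The second projection of the pseudopullback. -/
def projL (F : K ⥤ M) (G : L ⥤ M) : PsPull F G ⥤ L where
  obj a := a.l
  map f := f.hl

/-- `Ps(C, D)`: morphisms of the pseudopullback whose projections lie in `C` and `D`. -/
def PsClass (C : MorphismProperty K) (D : MorphismProperty L) :
    MorphismProperty (PsPull F G) :=
  fun _ _ f => C f.hk ∧ D f.hl

end PsPull


section Presentability

variable {κ : Cardinal.{v}}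

lemma isCardinalDirected_of_isCardinalFiltered [Fact κ.IsRegular] (P : Type v) [Preorder P]
    [IsCardinalFiltered P κ] : IsCardinalDirected P κ := fun S hS =>
  ⟨IsCardinalFiltered.max (fun s : S => (s : P)) (by rwa [hasCardinalLT_iff_cardinal_mk_lt]),
    fun s hs => leOfHom (IsCardinalFiltered.toMax (fun s : S => (s : P))
      (by rwa [hasCardinalLT_iff_cardinal_mk_lt]) ⟨s, hs⟩)⟩

lemma IsCardinalDirected.isCardinalFiltered [Fact κ.IsRegular] {P : Type v} [Preorder P]
    (hP : IsCardinalDirected P κ) : IsCardinalFiltered P κ :=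
  isCardinalFiltered_preorder P κ fun _ s hs => by
    obtain ⟨p, hp⟩ := hP (Set.range s) (Cardinal.mk_range_le.trans_lt hs)
    exact ⟨p, fun k => hp _ ⟨k, rfl⟩⟩

lemma isCardinalPresentable_iff_mathlib [Fact κ.IsRegular] (A : K) :
    IsCardinalPresentable κ A ↔ CategoryTheory.IsCardinalPresentable A κ := by
  constructor
  · intro h
    refine ⟨fun J _ _ => ?_⟩
    obtain ⟨P, _, _, F, _⟩ := IsCardinalFiltered.exists_cardinal_directed J κ
    have := (h P inferInstance (isCardinalDirected_of_isCardinalFiltered P)).some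
    exact Functor.Final.preservesColimitsOfShape_of_final F _
  · intro h P _ hP
    have := hP.isCardinalFiltered
    exact ⟨preservesColimitsOfShape_of_isCardinalPresentable A κ P⟩

lemma IsCardinalPresentable.of_isColimit (hκ : κ.IsRegular) {D : Type v} [SmallCategory D]
    (hD : HasCardinalLT (Arrow D) κ) {F : D ⥤ K} (hF : ∀ d, IsCardinalPresentable κ (F.obj d))
    {c : Cocone F} (hc : IsColimit c) : IsCardinalPresentable κ c.pt := by
  have : Fact κ.IsRegular := ⟨hκ⟩
  rw [isCardinalPresentable_iff_mathlib]
  have (d : D) : CategoryTheory.IsCardinalPresentable (F.obj d) κ :=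
    (isCardinalPresentable_iff_mathlib _).1 (hF d)
  exact isCardinalPresentable_of_isColimit' c hc κ hD

lemma hasCardinalLT_arrow_of_preorder (hκ : κ.IsRegular) {D : Type v} [Preorder D]
    (hD : Cardinal.mk D < κ) : HasCardinalLT (Arrow D) κ := by
  have h : HasCardinalLT D κ := by rwa [hasCardinalLT_iff_cardinal_mk_lt]
  refine (hasCardinalLT_prod hκ.aleph0_le h h).of_injective
    (fun f : Arrow D => (f.left, f.right)) ?_
  rintro ⟨a, b, f⟩ ⟨a', b', f'⟩ h
  obtain ⟨rfl, rfl⟩ := Prod.mk.inj h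
  obtain rfl : f = f' := Subsingleton.elim _ _
  rfl

lemma IsCardinalPresentable.of_isPushout (hκ : κ.IsRegular) {A B C D : K} {f : A ⟶ B} {g : A ⟶ C}
    {h : B ⟶ D} {k : C ⟶ D} (sq : IsPushout f g h k) (hA : IsCardinalPresentable κ A)
    (hB : IsCardinalPresentable κ B) (hC : IsCardinalPresentable κ C) :
    IsCardinalPresentable κ D := by
  have : Fact κ.IsRegular := ⟨hκ⟩
  rw [isCardinalPresentable_iff_mathlib] at *
  have (d : WalkingSpan) : CategoryTheory.IsCardinalPresentable ((span f g).obj d) κ := by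
    rcases d with _ | _ | _ <;> assumption
  exact isCardinalPresentable_of_isColimit' sq.cocone sq.isColimit κ
    (hasCardinalLT_of_finite _ _ hκ.aleph0_le)

lemma IsCardinalPresentable.of_isInitial (hκ : κ.IsRegular) {A : K} (hA : IsInitial A) :
    IsCardinalPresentable κ A := by
  have : Fact κ.IsRegular := ⟨hκ⟩
  rw [isCardinalPresentable_iff_mathlib]
  have (d : Discrete PEmpty.{1}) :
      CategoryTheory.IsCardinalPresentable ((Functor.empty K).obj d) κ := d.as.elim
  exact isCardinalPresentable_of_isColimit' (asEmptyCocone A) hA κ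
    (hasCardinalLT_of_finite _ _ hκ.aleph0_le)

end Presentability

section PushoutColimits

variable {D : Type*} [Category* D] {A G Z H : D ⥤ K} {α : A ⟶ G} {ζ : A ⟶ Z} {γ : G ⟶ H}
  {η : Z ⟶ H} {ca : Cocone A} {cg : Cocone G} {cz : Cocone Z} {ch : Cocone H}
  {a : ca.pt ⟶ cg.pt} {z : ca.pt ⟶ cz.pt} {g : cg.pt ⟶ ch.pt} {h : cz.pt ⟶ ch.pt}

/-- If three corners of a pushout square of cocones are colimits and the diagrams form
pointwise pushout squares, then the fourth corner is a colimit. -/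
lemma nonempty_isColimit_of_isPushout
    (sq : ∀ d, IsPushout (α.app d) (ζ.app d) (γ.app d) (η.app d))
    (hca : IsColimit ca) (hcg : IsColimit cg) (hcz : IsColimit cz) (sq' : IsPushout a z g h)
    (ha : ∀ d, ca.ι.app d ≫ a = α.app d ≫ cg.ι.app d)
    (hz : ∀ d, ca.ι.app d ≫ z = ζ.app d ≫ cz.ι.app d)
    (hg : ∀ d, cg.ι.app d ≫ g = γ.app d ≫ ch.ι.app d)
    (hh : ∀ d, cz.ι.app d ≫ h = η.app d ≫ ch.ι.app d) : Nonempty (IsColimit ch) := by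
  let sg (s : Cocone H) : Cocone G := (Cocone.precompose γ).obj s
  let sz (s : Cocone H) : Cocone Z := (Cocone.precompose η).obj s
  have w (s : Cocone H) : a ≫ hcg.desc (sg s) = z ≫ hcz.desc (sz s) := by
    refine hca.hom_ext fun d => ?_
    rw [reassoc_of% ha, reassoc_of% hz, hcg.fac, hcz.fac]
    exact (sq d).w_assoc _
  refine ⟨⟨fun s => sq'.desc _ _ (w s), fun s d => ?_, fun s m hm => ?_⟩⟩
  · refine (sq d).hom_ext ?_ ?_
    · rw [← reassoc_of% hg, sq'.inl_desc, hcg.fac]; rfl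
    · rw [← reassoc_of% hh, sq'.inr_desc, hcz.fac]; rfl
  · refine sq'.hom_ext ?_ ?_
    · rw [sq'.inl_desc]
      refine hcg.hom_ext fun d => ?_
      rw [reassoc_of% hg, hm, hcg.fac]; rfl
    · rw [sq'.inr_desc]
      refine hcz.hom_ext fun d => ?_
      rw [reassoc_of% hh, hm, hcz.fac]; rfl

/-- A colimit of pushout squares is a pushout square. -/
lemma isPushout_of_isColimit
    (sq : ∀ d, IsPushout (α.app d) (ζ.app d) (γ.app d) (η.app d))
    (hca : IsColimit ca) (hcg : IsColimit cg) (hcz : IsColimit cz) (hch : IsColimit ch)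
    (ha : ∀ d, ca.ι.app d ≫ a = α.app d ≫ cg.ι.app d)
    (hz : ∀ d, ca.ι.app d ≫ z = ζ.app d ≫ cz.ι.app d)
    (hg : ∀ d, cg.ι.app d ≫ g = γ.app d ≫ ch.ι.app d)
    (hh : ∀ d, cz.ι.app d ≫ h = η.app d ≫ ch.ι.app d) : IsPushout a z g h := by
  have w : a ≫ g = z ≫ h := hca.hom_ext fun d => by
    rw [reassoc_of% ha, reassoc_of% hz, hg, hh, (sq d).w_assoc]
  have w' (s : PushoutCocone a z) (d : D) :
      α.app d ≫ cg.ι.app d ≫ s.inl = ζ.app d ≫ cz.ι.app d ≫ s.inr := by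
    rw [← reassoc_of% ha, ← reassoc_of% hz, s.condition]
  let sh (s : PushoutCocone a z) : Cocone H :=
    { pt := s.pt
      ι :=
        { app d := (sq d).desc _ _ (w' s d)
          naturality d d' f := by
            refine (sq d).hom_ext ?_ ?_
            · rw [← γ.naturality_assoc, (sq d').inl_desc, cg.w_assoc]
              simp
            · rw [← η.naturality_assoc, (sq d').inr_desc, cz.w_assoc]
              simp } }
  refine ⟨⟨w⟩, ⟨PushoutCocone.IsColimit.mk w (fun s => hch.desc (sh s)) (fun s => ?_)
    (fun s => ?_) fun s m hm hm' => ?_⟩⟩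
  · refine hcg.hom_ext fun d => ?_
    rw [reassoc_of% hg, hch.fac]
    exact (sq d).inl_desc _ _ _
  · refine hcz.hom_ext fun d => ?_
    rw [reassoc_of% hh, hch.fac]
    exact (sq d).inr_desc _ _ _
  · refine hch.hom_ext fun d => ?_
    rw [hch.fac]
    refine (sq d).hom_ext ?_ ?_
    · rw [← reassoc_of% hg, hm]
      exact ((sq d).inl_desc _ _ _).symm
    · rw [← reassoc_of% hh, hm']
      exact ((sq d).inr_desc _ _ _).symm

end PushoutColimits

section PushoutChains

variable {X : MorphismProperty K}

lemma Po.of_isPushout {P Q P' Q' : K} {q : P ⟶ Q} {u : P ⟶ P'} {w : Q ⟶ Q'} {m : P' ⟶ Q'}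
    (hq : Po X q) (sq : IsPushout q u w m) : Po X m := by
  obtain ⟨A, B, f, u', w', hf, sq'⟩ := hq
  exact ⟨A, B, f, _, _, hf, sq'.paste_vert sq⟩

/-- A morphism of arrows `(A₀ ⟶ G₀) ⟶ (A₁ ⟶ G₁)` is a relative cell of `X` when the induced
morphism `A₁ ⊔_{A₀} G₀ ⟶ G₁` is a pushout of a morphism of `X`. -/
def IsRelativeCell (X : MorphismProperty K) : MorphismProperty (Arrow K) :=
  fun s t φ => ∃ (Q : K) (b : s.right ⟶ Q) (c : t.left ⟶ Q) (q : Q ⟶ t.right),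
    IsPushout s.hom φ.left b c ∧ b ≫ q = φ.right ∧ c ≫ q = t.hom ∧ Po X q

lemma IsRelativeCell.po_of_isPushout {s t : Arrow K} {φ : s ⟶ t} (hφ : IsRelativeCell X φ)
    {Z H H' : K} {z : t.left ⟶ Z} {g : s.right ⟶ H} {h : Z ⟶ H} {g' : t.right ⟶ H'}
    {h' : Z ⟶ H'} {m : H ⟶ H'} (sq : IsPushout s.hom (φ.left ≫ z) g h)
    (sq' : IsPushout t.hom z g' h') (hg : g ≫ m = φ.right ≫ g') (hh : h ≫ m = h') :
    Po X m := by
  obtain ⟨Q, b, c, q, sQ, hb, hc, hq⟩ := hφ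
  subst hh
  have w : s.hom ≫ g = φ.left ≫ z ≫ h := by simpa using sq.w
  have sq₁ : IsPushout c z (sQ.desc g (z ≫ h) w) h :=
    IsPushout.of_top (v₁₂ := b) (by simpa using sq) (by simp) sQ
  rw [← hc] at sq'
  refine hq.of_isPushout (IsPushout.of_left sq' ?_ sq₁)
  refine sQ.hom_ext ?_ ?_
  · rw [reassoc_of% hb, sQ.inl_desc_assoc, hg]
  · rw [sQ.inr_desc_assoc, Category.assoc, ← sq'.w, Category.assoc]

variable [HasPushouts K] {κ : Cardinal.{v}} {J : Type v} [LinearOrder J] [SuccOrder J] [OrderBot J]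
  [WellFoundedLT J]

/-- Given a smooth chain of arrows starting at an isomorphism, whose links are relative cells,
any pushout of its colimit is a transfinite composite of pushouts of `X`. -/
lemma isBoundedTransfiniteCompositionOf_of_isPushout (hJ : Cardinal.mk J < κ) (Γ : J ⥤ Arrow K)
    {ca : Cocone (Γ ⋙ Arrow.leftFunc)} {cg : Cocone (Γ ⋙ Arrow.rightFunc)}
    (hca : IsColimit ca) (hcg : IsColimit cg) {Z B : K}
    {a : ca.pt ⟶ cg.pt} {z : ca.pt ⟶ Z} {g : cg.pt ⟶ B} {h : Z ⟶ B} (sq : IsPushout a z g h)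
    (ha : ∀ j, ca.ι.app j ≫ a = (Γ.obj j).hom ≫ cg.ι.app j) (hbot : IsIso (Γ.obj ⊥).hom)
    (hleft : ∀ j, Order.IsSuccLimit j →
      Nonempty (IsColimit (coconeLT (Γ ⋙ Arrow.leftFunc) j)))
    (hright : ∀ j, Order.IsSuccLimit j →
      Nonempty (IsColimit (coconeLT (Γ ⋙ Arrow.rightFunc) j)))
    (hcell : ∀ j, ¬ IsMax j → IsRelativeCell X (Γ.map (homOfLE (Order.le_succ j))))
    (S : ObjectProperty K)
    (hS : ∀ j {P : K} (g' : (Γ.obj j).right ⟶ P) (h' : Z ⟶ P),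
      IsPushout (Γ.obj j).hom (ca.ι.app j ≫ z) g' h' → S P) :
    IsBoundedTransfiniteCompositionOf κ (fun P P' m => Po X m ∧ S P ∧ S P') h := by
  let α : Γ ⋙ Arrow.leftFunc ⟶ Γ ⋙ Arrow.rightFunc := Functor.whiskerLeft Γ Arrow.leftToRight
  let ζ : Γ ⋙ Arrow.leftFunc ⟶ (Functor.const J).obj Z := ca.ι ≫ (Functor.const J).map z
  let γ := pushout.inl α ζ
  let η := pushout.inr α ζ
  have sqs (j : J) : IsPushout (α.app j) (ζ.app j) (γ.app j) (η.app j) :=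
    (IsPushout.of_hasPushout α ζ).map ((evaluation J K).obj j)
  let ch : Cocone (pushout α ζ) :=
    { pt := B
      ι := pushout.desc (cg.ι ≫ (Functor.const J).map g) ((Functor.const J).map h) (by
        ext j
        exact (Category.assoc _ _ _).symm.trans <| ((reassoc_of% ha j) g).symm.trans
          ((congr(ca.ι.app j ≫ $sq.w)).trans (Category.assoc _ _ _).symm)) }
  have hγ (j : J) : γ.app j ≫ ch.ι.app j = cg.ι.app j ≫ g := by
    rw [← NatTrans.comp_app, pushout.inl_desc]; rfl
  have hη (j : J) : η.app j ≫ ch.ι.app j = h := by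
    rw [← NatTrans.comp_app, pushout.inr_desc]; rfl
  obtain ⟨hch⟩ := nonempty_isColimit_of_isPushout sqs hca hcg (isColimitConstCocone J Z) (ch := ch)
    sq ha (fun j => (Category.comp_id _).symm) (fun j => (hγ j).symm)
    (fun j => (Category.id_comp _).trans (hη j).symm)
  have hbot' : IsIso (η.app ⊥) := by
    have : IsIso (α.app ⊥) := hbot
    exact (sqs ⊥).isIso_inr_of_isIso
  refine ⟨J, inferInstance, inferInstance, inferInstance, inferInstance, hJ, _, ch, hch,
    asIso (η.app ⊥), Iso.refl _, fun j hj => ⟨?_, hS _ _ _ (sqs _), hS _ _ _ (sqs _)⟩,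
    fun j hj => ?_, by simp [hη]⟩
  · refine (hcell j hj).po_of_isPushout (z := ζ.app _) (g := γ.app j) (h := η.app j) ?_ (sqs _)
      (γ.naturality _).symm ?_
    · have h₁ := sqs j
      rw [← (ζ.naturality (homOfLE (Order.le_succ j))).trans (Category.comp_id _)] at h₁
      exact h₁
    · exact (η.naturality _).symm.trans (Category.id_comp _)
  · obtain ⟨hl⟩ := hleft j hj
    obtain ⟨hr⟩ := hright j hj
    have : Nonempty {i : J // i < j} := ⟨⟨⊥, hj.bot_lt⟩⟩
    let ι : {i : J // i < j} ⥤ J :=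
      Monotone.functor (f := fun i : {i : J // i < j} => (i : J)) fun _ _ h => h
    exact nonempty_isColimit_of_isPushout (α := Functor.whiskerLeft ι α)
      (ζ := Functor.whiskerLeft ι ζ) (γ := Functor.whiskerLeft ι γ) (η := Functor.whiskerLeft ι η)
      (fun i => sqs i) hl hr (isColimitConstCocone _ Z) (sqs j)
      (fun i => α.naturality _) (fun i => ζ.naturality _) (fun i => γ.naturality (homOfLE i.2.le))
      (fun i => η.naturality (homOfLE i.2.le))

end PushoutChains

section RelativeCells

variable {κ : Cardinal.{v}}

lemma IsCardinalPresentable.of_iso (hκ : κ.IsRegular) {A B : K} (e : A ≅ B)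
    (hA : IsCardinalPresentable κ A) : IsCardinalPresentable κ B := by
  have : Fact κ.IsRegular := ⟨hκ⟩
  rw [isCardinalPresentable_iff_mathlib] at *
  exact isCardinalPresentable_of_iso e κ

lemma IsLocallyPresentable.exists_colimitPresentation (hK : IsLocallyPresentable κ K) (A : K) :
    ∃ (P : Type v) (_ : Preorder P) (p : ColimitPresentation P A),
      IsCardinalDirected P κ ∧ ∀ x, IsCardinalPresentable κ (p.diag.obj x) := by
  obtain ⟨ι, G, hG, h⟩ := hK.generators
  obtain ⟨P, _, F, c, hc, hP, ⟨e⟩, hF⟩ := h A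
  refine ⟨P, inferInstance, ColimitPresentation.ofIso ⟨F, c.ι, hc⟩ e, hP, fun x => ?_⟩
  obtain ⟨i, ⟨e'⟩⟩ := hF x
  exact (hG i).of_iso hK.regular e'.symm

/-- A morphism `s` from a presentable object to a pushout of a morphism `i` between presentable
objects factors through a pushout of `i` to a presentable object. -/
lemma IsLocallyPresentable.exists_lift_of_isPushout (hK : IsLocallyPresentable κ K)
    {A₀ G₀ A F C : K} {i : A₀ ⟶ G₀} {a : A₀ ⟶ A} {g : G₀ ⟶ F} {t : A ⟶ F}
    (sq : IsPushout i a g t) (hA₀ : IsCardinalPresentable κ A₀) (hC : IsCardinalPresentable κ C)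
    (s : C ⟶ F) :
    ∃ (A₁ Q : K) (p : A₀ ⟶ A₁) (a₁ : A₁ ⟶ A) (b : G₀ ⟶ Q) (c : A₁ ⟶ Q) (q : Q ⟶ F)
      (s' : C ⟶ Q), IsCardinalPresentable κ A₁ ∧ p ≫ a₁ = a ∧ IsPushout i p b c ∧ b ≫ q = g ∧
        c ≫ q = a₁ ≫ t ∧ s' ≫ q = s := by
  have : Fact κ.IsRegular := ⟨hK.regular⟩
  have := hK.hasColimits
  obtain ⟨P, _, pres, hP, hpres⟩ := hK.exists_colimitPresentation A
  have := hP.isCardinalFiltered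
  have := isFiltered_of_isCardinalFiltered P κ
  rw [isCardinalPresentable_iff_mathlib] at hA₀ hC
  obtain ⟨p₀, p, hp⟩ := IsCardinalPresentable.exists_hom_of_isColimit κ pres.isColimit a
  have := isFiltered_of_isCardinalFiltered (Under p₀) κ
  have := IsFiltered.isConnected (Under p₀)
  let pres' := pres.reindex (Under.forget p₀)
  let α : (Functor.const (Under p₀)).obj A₀ ⟶ (Functor.const (Under p₀)).obj G₀ :=
    (Functor.const _).map i
  let ζ : (Functor.const (Under p₀)).obj A₀ ⟶ pres'.diag :=
    { app u := p ≫ pres.diag.map u.hom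
      naturality u u' f := by
        refine (Category.id_comp _).trans (Eq.trans ?_ (Category.assoc _ _ _).symm)
        exact congr(p ≫ $((congr(pres.diag.map $(Under.w f)).symm.trans
          (pres.diag.map_comp _ _)))) }
  have sqs (u : Under p₀) : IsPushout (α.app u) (ζ.app u) ((pushout.inl α ζ).app u)
      ((pushout.inr α ζ).app u) :=
    (IsPushout.of_hasPushout α ζ).map ((evaluation _ K).obj u)
  have hζ (u : Under p₀) : ζ.app u ≫ pres'.ι.app u = a :=
    (Category.assoc _ _ _).trans (congr(p ≫ $(pres.w u.hom)).trans hp)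
  let ch : Cocone (pushout α ζ) :=
    { pt := F
      ι := pushout.desc ((Functor.const _).map g) (pres'.ι ≫ (Functor.const _).map t) (by
        ext u
        exact sq.w.trans ((congr($(hζ u) ≫ t)).symm.trans (Category.assoc _ _ _))) }
  have hγ (u : Under p₀) : (pushout.inl α ζ).app u ≫ ch.ι.app u = g := by
    rw [← NatTrans.comp_app, pushout.inl_desc]; rfl
  have hη (u : Under p₀) : (pushout.inr α ζ).app u ≫ ch.ι.app u = pres'.ι.app u ≫ t := by
    rw [← NatTrans.comp_app, pushout.inr_desc]; rfl
  obtain ⟨hch⟩ := nonempty_isColimit_of_isPushout sqs (isColimitConstCocone _ A₀)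
    (isColimitConstCocone _ G₀) pres'.isColimit (ch := ch) sq
    (fun u => (Category.id_comp _).trans (Category.comp_id _).symm)
    (fun u => (Category.id_comp _).trans (hζ u).symm)
    (fun u => (Category.id_comp _).trans (hγ u).symm)
    (fun u => (hη u).symm)
  obtain ⟨u, s', hs'⟩ := IsCardinalPresentable.exists_hom_of_isColimit κ hch s
  exact ⟨_, _, ζ.app u, pres'.ι.app u, _, _, ch.ι.app u, s', hpres _, hζ u, sqs u, hγ u, hη u, hs'⟩

/-- A presentation of `t : A ⟶ F` as a pushout of an arrow between presentable objects extends
along any pushout `F ⟶ F'` of a morphism of `X`. -/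
lemma IsLocallyPresentable.exists_isRelativeCell (hK : IsLocallyPresentable κ K)
    {X : MorphismProperty K}
    (hX : ∀ ⦃A B : K⦄ (f : A ⟶ B), X f →
      IsCardinalPresentable κ A ∧ IsCardinalPresentable κ B)
    {s : Arrow K} (hs : IsCardinalPresentable κ s.left) (hs' : IsCardinalPresentable κ s.right)
    {A F F' : K} {a : s.left ⟶ A} {g : s.right ⟶ F} {t : A ⟶ F} (sq : IsPushout s.hom a g t)
    {m : F ⟶ F'} (hm : Po X m) :
    ∃ (s' : Arrow K) (φ : s ⟶ s') (a' : s'.left ⟶ A) (g' : s'.right ⟶ F'),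
      IsCardinalPresentable κ s'.left ∧ IsCardinalPresentable κ s'.right ∧
        IsPushout s'.hom a' g' (t ≫ m) ∧ φ.left ≫ a' = a ∧ φ.right ≫ g' = g ≫ m ∧
          IsRelativeCell X φ := by
  have := hK.hasColimits
  obtain ⟨C, D, f, u, w, hf, sqm⟩ := hm
  obtain ⟨hC, hD⟩ := hX f hf
  obtain ⟨A₁, Q, p, a₁, b, c, q, u', hA₁, hp, sqQ, hb, hc, hu⟩ :=
    hK.exists_lift_of_isPushout sq hs hC u
  have sq₁ : IsPushout c a₁ q t := IsPushout.of_top (by rwa [hp, hb]) hc sqQ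
  have sqG := IsPushout.of_hasPushout f u'
  have w₁ : f ≫ w = u' ≫ q ≫ m := by rw [reassoc_of% hu, sqm.w]
  have sq₂ : IsPushout (pushout.inr f u') q (sqG.desc w (q ≫ m) w₁) m :=
    IsPushout.of_top (by rwa [sqG.inl_desc, hu]) (by simp) sqG
  refine ⟨Arrow.mk (c ≫ pushout.inr f u'), Arrow.homMk p (b ≫ pushout.inr f u') ?_, a₁,
    sqG.desc w (q ≫ m) w₁, hA₁, ?_, sq₁.paste_horiz sq₂, hp, ?_, Q, b, c, pushout.inr f u', sqQ,
    rfl, rfl, C, D, f, u', _, hf, sqG⟩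
  · simpa using (sqQ.w_assoc _).symm
  · exact .of_isPushout hK.regular sqG hC hD (.of_isPushout hK.regular sqQ hs hs' hA₁)
  · simp [reassoc_of% hb]

end RelativeCells

section Chains

variable {J : Type v} [LinearOrder J] [SuccOrder J] [OrderBot J] [WellFoundedLT J]

/-- Transfinite iteration of a non-deterministic step. -/
lemma exists_smooth_chain {C : Type*} [Category* C] [HasIterationOfShape J C] (X₀ : C)
    (W : MorphismProperty C) :
    ∃ Ψ : J ⥤ C, Ψ.obj ⊥ = X₀ ∧
      (∀ j, Order.IsSuccLimit j → Nonempty (IsColimit (coconeLT Ψ j))) ∧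
      ∀ j, ¬ IsMax j → (∃ (Y : C) (φ : Ψ.obj j ⟶ Y), W φ) →
        W (Ψ.map (homOfLE (Order.le_succ j))) := by
  classical
  have h (x : C) : ∃ (Y : C) (φ : x ⟶ Y), (∃ (Y' : C) (φ' : x ⟶ Y'), W φ') → W φ := by
    by_cases hx : ∃ (Y' : C) (φ' : x ⟶ Y'), W φ'
    · obtain ⟨Y, φ, hφ⟩ := hx
      exact ⟨Y, φ, fun _ => hφ⟩
    · exact ⟨x, 𝟙 x, fun h => (hx h).elim⟩
  choose s t hst using h
  let Φ : SmallObject.SuccStruct C := { X₀ := X₀, succ := s, toSucc := t }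
  refine ⟨Φ.iterationFunctor J, (Φ.iter ⊥).obj_bot, fun j hj =>
    ⟨(Φ.iterationFunctor J).isColimitOfIsWellOrderContinuous j hj⟩, fun j hj => ?_⟩
  have key {x y : C} (φ : x ⟶ y) (hφ : Φ.prop φ) (hx : ∃ (Y : C) (φ : x ⟶ Y), W φ) : W φ := by
    obtain ⟨x⟩ := hφ
    exact hst x hx
  exact key _ (Φ.prop_iterationFunctor_map_succ j hj)

instance hasColimitsOfSize_withTop : HasColimitsOfSize.{v, v} (WithTop J) where
  has_colimits_of_shape D _ :=
    { has_colimit R := by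
        rw [Preorder.hasColimit_iff_hasLUB]
        obtain ⟨x, hx, hx'⟩ := WellFounded.has_min (wellFounded_lt (α := WithTop J))
          (upperBounds (Set.range R.obj)) ⟨⊤, fun _ _ => le_top⟩
        exact ⟨x, hx, fun y hy => not_lt.1 (hx' y hy)⟩ }

/-- The inclusion of `J` in `WithTop J`. -/
def withTopFunctor (J : Type v) [Preorder J] : J ⥤ WithTop J :=
  Monotone.functor (f := fun j : J => (j : WithTop J)) fun _ _ h => WithTop.coe_le_coe.2 h

lemma eq_withTopFunctor {J : Type v} [Preorder J] {D : Type*} [Category* D] {R : D ⥤ WithTop J} (G : D ⥤ J)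
    (hR : ∀ d, R.obj d = (G.obj d : WithTop J)) : R = G ⋙ withTopFunctor J :=
  CategoryTheory.Functor.ext hR fun _ _ _ => Subsingleton.elim _ _

/-- The extension of a functor `F : J ⥤ K` by the point of a cocone. -/
def coconeExtension {J : Type v} [Preorder J] {F : J ⥤ K} (c : Cocone F) : WithTop J ⥤ K where
  obj
    | ⊤ => c.pt
    | (j : J) => F.obj j
  map {a b} h := match a, b, h with
    | ⊤, ⊤, _ => 𝟙 c.pt
    | (i : J), ⊤, _ => c.ι.app i
    | (i : J), (j : J), h => F.map (homOfLE (WithTop.coe_le_coe.1 h.le))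
    | ⊤, (j : J), h => (WithTop.not_top_le_coe j h.le).elim
  map_id a := by
    cases a
    · rfl
    · exact F.map_id _
  map_comp {a b d} f g := by
    rcases a with _ | i <;> rcases b with _ | j <;> rcases d with _ | k
    all_goals first
      | exact (WithTop.not_top_le_coe _ f.le).elim
      | exact (WithTop.not_top_le_coe _ g.le).elim
      | skip
    · exact (Category.id_comp _).symm
    · exact (Category.comp_id _).symm
    · exact (c.w _).symm
    · exact F.map_comp _ _

/-- The functor sending `i` to the morphism `G.obj ⊥ ⟶ G.obj i`. -/
@[simps]
def arrowOfBot {I : Type*} [Preorder I] [OrderBot I] (G : I ⥤ K) : I ⥤ Arrow K where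
  obj i := Arrow.mk (G.map (homOfLE (bot_le : ⊥ ≤ i)))
  map {i j} f := Arrow.homMk (𝟙 _) (G.map f) (by
    simp only [Arrow.mk_left, Arrow.mk_right, Arrow.mk_hom, Category.id_comp, ← G.map_comp]
    rfl)
  map_id i := by ext <;> simp
  map_comp f g := by ext <;> simp

lemma isPushout_app_of_isColimit {C D : Type*} [Category* C] [Category* D] {A G Z H : C ⥤ K}
    {α : A ⟶ G} {ζ : A ⟶ Z} {γ : G ⟶ H} {η : Z ⟶ H} {R : D ⥤ C} {c : Cocone R}
    (hA : IsColimit (A.mapCocone c)) (hG : IsColimit (G.mapCocone c))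
    (hZ : IsColimit (Z.mapCocone c)) (hH : IsColimit (H.mapCocone c))
    (sq : ∀ d, IsPushout (α.app (R.obj d)) (ζ.app (R.obj d)) (γ.app (R.obj d))
      (η.app (R.obj d))) :
    IsPushout (α.app c.pt) (ζ.app c.pt) (γ.app c.pt) (η.app c.pt) :=
  isPushout_of_isColimit (α := Functor.whiskerLeft R α) (ζ := Functor.whiskerLeft R ζ)
    (γ := Functor.whiskerLeft R γ) (η := Functor.whiskerLeft R η) sq hA hG hZ hH
    (fun _ => α.naturality _) (fun _ => ζ.naturality _) (fun _ => γ.naturality _)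
    (fun _ => η.naturality _)

lemma isLUB_range_coe {J : Type v} [LinearOrder J] [SuccOrder J] {j : J} (hj : Order.IsSuccLimit j) :
    IsLUB (Set.range fun i : {i : J // i < j} => ((i : J) : WithTop J)) j := by
  refine ⟨?_, fun y hy => ?_⟩
  · rintro _ ⟨i, rfl⟩
    exact WithTop.coe_le_coe.2 i.2.le
  · rcases y with _ | k
    · exact le_top
    · refine WithTop.coe_le_coe.2 (not_lt.1 fun hk => ?_)
      have := WithTop.coe_le_coe.1 (hy ⟨⟨Order.succ k, hj.succ_lt hk⟩, rfl⟩)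
      exact (Order.lt_succ_of_not_isMax hk.not_isMax).not_ge this

lemma nonempty_isColimit_coconeExtension {J : Type v} [Preorder J] {F : J ⥤ K} (c : Cocone F) {j : J}
    (hj : Nonempty (IsColimit (coconeLT F j))) {R : {i : J // i < j} ⥤ WithTop J}
    (hR : ∀ i, R.obj i = (i : J)) (r : Cocone R) (hr : r.pt = j) :
    Nonempty (IsColimit ((coconeExtension c).mapCocone r)) := by
  obtain rfl := eq_withTopFunctor (Monotone.functor (f := fun i : {i : J // i < j} => (i : J))
    fun _ _ h => h) hR
  obtain ⟨t, ρ⟩ := r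
  obtain rfl : t = j := hr
  exact hj

end Chains

section PresentableChains

variable {κ : Cardinal.{v}} {J : Type v} [LinearOrder J] [SuccOrder J] [OrderBot J]
  [WellFoundedLT J]

/-- A smooth chain of pushouts of `X` is a pushout of a smooth chain of arrows between presentable
objects. -/
lemma IsLocallyPresentable.exists_isRelativeCell_chain (hK : IsLocallyPresentable κ K)
    {X : MorphismProperty K}
    (hX : ∀ ⦃A B : K⦄ (f : A ⟶ B), X f →
      IsCardinalPresentable κ A ∧ IsCardinalPresentable κ B)
    (hJ : Cardinal.mk J < κ) (F : J ⥤ K)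
    (hF : ∀ j : J, ¬IsMax j → Po X (F.map (homOfLE (Order.le_succ j))))
    (hlim : ∀ j : J, Order.IsSuccLimit j → Nonempty (IsColimit (coconeLT F j))) :
    ∃ (Γ : J ⥤ Arrow K) (τ : Γ ⟶ arrowOfBot F),
      (∀ j, IsCardinalPresentable κ (Γ.obj j).left ∧ IsCardinalPresentable κ (Γ.obj j).right ∧
        IsPushout (Γ.obj j).hom (τ.app j).left (τ.app j).right ((arrowOfBot F).obj j).hom) ∧
      IsIso (Γ.obj ⊥).hom ∧
      (∀ j, Order.IsSuccLimit j → Nonempty (IsColimit (coconeLT (Γ ⋙ Arrow.leftFunc) j))) ∧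
      (∀ j, Order.IsSuccLimit j → Nonempty (IsColimit (coconeLT (Γ ⋙ Arrow.rightFunc) j))) ∧
      ∀ j, ¬ IsMax j → IsRelativeCell X (Γ.map (homOfLE (Order.le_succ j))) := by
  have := hK.hasColimits
  let c : Cocone F := colimit.cocone F
  let T : WithTop J ⥤ Arrow K := arrowOfBot (coconeExtension c)
  let C := Comma (𝟭 (Arrow K)) T
  have : HasColimitsOfSize.{v, v} (Arrow K) := { has_colimits_of_shape _ _ := inferInstance }
  have : HasColimitsOfSize.{v, v} C := Comma.hasColimitsOfSize
  let Good (j : J) (x : C) : Prop :=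
    x.right = (j : WithTop J) ∧ IsCardinalPresentable κ x.left.left ∧
      IsCardinalPresentable κ x.left.right ∧
        IsPushout x.left.hom x.hom.left x.hom.right (T.obj x.right).hom
  let W : MorphismProperty C := fun x y φ => ∀ j : J, ¬ IsMax j → x.right = (j : WithTop J) →
    Good (Order.succ j) y ∧ IsRelativeCell X φ.left
  let X₀ : C := ⟨Arrow.mk (𝟙 (⊥_ K)), ((⊥ : J) : WithTop J),
    Arrow.homMk (initial.to _) (initial.to _) (initialIsInitial.hom_ext _ _)⟩
  have hX₀ : Good ⊥ X₀ := by
    refine ⟨rfl, .of_isInitial hK.regular initialIsInitial,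
      .of_isInitial hK.regular initialIsInitial, ?_⟩
    have : IsIso (T.obj X₀.right).hom := by
      change IsIso (F.map (𝟙 ⊥))
      infer_instance
    have : IsIso X₀.left.hom := by
      change IsIso (𝟙 (⊥_ K))
      infer_instance
    exact IsPushout.of_horiz_isIso ⟨X₀.hom.w.symm⟩
  have step (j : J) (hj : ¬ IsMax j) (x : C) (hx : Good j x) : ∃ (y : C) (φ : x ⟶ y), W φ := by
    obtain ⟨s, r, τ⟩ := x
    obtain ⟨hr, hs, hs', sq⟩ := hx
    obtain rfl : r = j := hr
    obtain ⟨s', φ, a', g', h₁, h₂, sq', ha, hg, hφ⟩ :=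
      hK.exists_isRelativeCell hX hs hs' sq (hF j hj)
    have e : (T.obj j).hom ≫ F.map (homOfLE (Order.le_succ j)) =
        (T.obj (Order.succ j : J)).hom := (F.map_comp _ _).symm
    rw [e] at sq'
    let y : C := ⟨s', (Order.succ j : J), Arrow.homMk a' g' sq'.w.symm⟩
    refine ⟨y, ⟨φ, homOfLE (WithTop.coe_le_coe.2 (Order.le_succ j)), ?_⟩, fun i _ hi => ?_⟩
    · ext
      · exact ha.trans (Category.comp_id _).symm
      · exact hg
    · obtain rfl := WithTop.coe_injective hi
      exact ⟨⟨rfl, h₁, h₂, sq'⟩, hφ⟩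
  obtain ⟨Ψ, h₀, hΨ, hs⟩ := exists_smooth_chain (J := J) X₀ W
  let A := Comma.fst (𝟭 (Arrow K)) T ⋙ Arrow.leftFunc
  let G := Comma.fst (𝟭 (Arrow K)) T ⋙ Arrow.rightFunc
  let N := Comma.natTrans (𝟭 (Arrow K)) T
  have good (j : J) : Good j (Ψ.obj j) := by
    induction j using SuccOrder.limitRecOn with
    | isMin j hj =>
      obtain rfl := hj.eq_bot
      rwa [h₀]
    | succ j hj ih => exact (hs j hj (step j hj _ ih) j hj ih.1).1
    | isSuccLimit j hj ih =>
      obtain ⟨hc⟩ := hΨ j hj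
      have hI : HasCardinalLT (Arrow {i : J // i < j}) κ :=
        hasCardinalLT_arrow_of_preorder hK.regular ((Cardinal.mk_subtype_le _).trans_lt hJ)
      have hR (i : {i : J // i < j}) :
          (restrictionLT Ψ j ⋙ Comma.snd (𝟭 (Arrow K)) T).obj i = (i : J) := (ih i i.2).1
      have hA := isColimitOfPreserves A hc
      have hG := isColimitOfPreserves G hc
      have hr : (Ψ.obj j).right = j := by
        have := Preorder.isLUB_of_isColimit _
          (isColimitOfPreserves (Comma.snd (𝟭 (Arrow K)) T) hc)
        refine this.unique ?_
        convert isLUB_range_coe hj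
        exact hR _
      refine ⟨hr, IsCardinalPresentable.of_isColimit hK.regular hI (fun i => (ih i i.2).2.1) hA,
        IsCardinalPresentable.of_isColimit hK.regular hI (fun i => (ih i i.2).2.2.1) hG, ?_⟩
      have : Nonempty {i : J // i < j} := ⟨⟨⊥, hj.bot_lt⟩⟩
      have hZ : IsColimit ((Comma.snd (𝟭 (Arrow K)) T ⋙ T ⋙ Arrow.leftFunc).mapCocone
        (coconeLT Ψ j)) := isColimitConstCocone _ (F.obj ⊥)
      obtain ⟨hH⟩ := nonempty_isColimit_coconeExtension c (hlim j hj) hR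
        ((Comma.snd (𝟭 (Arrow K)) T).mapCocone (coconeLT Ψ j)) hr
      exact isPushout_app_of_isColimit (A := A) (G := G)
        (Z := Comma.snd (𝟭 (Arrow K)) T ⋙ T ⋙ Arrow.leftFunc)
        (H := Comma.snd (𝟭 (Arrow K)) T ⋙ coconeExtension c)
        (α := Functor.whiskerLeft (Comma.fst _ _) Arrow.leftToRight)
        (ζ := Functor.whiskerRight N Arrow.leftFunc)
        (γ := Functor.whiskerRight N Arrow.rightFunc)
        (η := Functor.whiskerLeft (Comma.snd _ _ ⋙ T) Arrow.leftToRight)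
        hA hG hZ hH (fun i => (ih i i.2).2.2.2)
  have key (R : J ⥤ WithTop J) (hR : ∀ j, R.obj j = j) (τ : Ψ ⋙ Comma.fst _ _ ⟶ R ⋙ T)
      (sq : ∀ j, IsPushout (Ψ.obj j).left.hom (τ.app j).left (τ.app j).right
        (T.obj (R.obj j)).hom) :
      ∃ τ : Ψ ⋙ Comma.fst _ _ ⟶ arrowOfBot F, ∀ j, IsPushout (Ψ.obj j).left.hom
        (τ.app j).left (τ.app j).right ((arrowOfBot F).obj j).hom := by
    obtain rfl := eq_withTopFunctor (𝟭 J) hR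
    exact ⟨τ, sq⟩
  obtain ⟨τ, sq⟩ := key (Ψ ⋙ Comma.snd _ _) (fun j => (good j).1) (Functor.whiskerLeft Ψ N)
    (fun j => (good j).2.2.2)
  refine ⟨Ψ ⋙ Comma.fst _ _, τ, fun j => ⟨(good j).2.1, (good j).2.2.1, sq j⟩, ?_,
    fun j hj => ⟨isColimitOfPreserves A (hΨ j hj).some⟩,
    fun j hj => ⟨isColimitOfPreserves G (hΨ j hj).some⟩,
    fun j hj => (hs j hj (step j hj _ (good j)) j hj (good j).1).2⟩
  change IsIso (Ψ.obj ⊥).left.hom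
  rw [h₀]
  change IsIso (𝟙 (⊥_ K))
  infer_instance

end PresentableChains

lemma IsBoundedTransfiniteCompositionOf.mono {κ : Cardinal.{v}} {C D : MorphismProperty K}
    (h : C ≤ D) {A B : K} {f : A ⟶ B} (hf : IsBoundedTransfiniteCompositionOf κ C f) :
    IsBoundedTransfiniteCompositionOf κ D f := by
  obtain ⟨J, _, _, _, _, hJ, F, c, hc, eA, eB, hF, hlim, hf⟩ := hf
  exact ⟨J, inferInstance, inferInstance, inferInstance, inferInstance, hJ, F, c, hc, eA, eB, fun j hj => h _ (hF j hj), hlim, hf⟩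

/-- Transfinite composites of pushouts of `X` are stable under pushouts. -/
lemma IsBoundedTransfiniteCompositionOf.of_isPushout [HasPushouts K] {κ : Cardinal.{v}}
    {X : MorphismProperty K} {A B A' B' : K} {f : A ⟶ B} {u : A ⟶ A'} {w : B ⟶ B'} {f' : A' ⟶ B'}
    (hf : IsBoundedTransfiniteCompositionOf κ (Po X) f) (sq : IsPushout f u w f') :
    IsBoundedTransfiniteCompositionOf κ (Po X) f' := by
  obtain ⟨J, _, _, _, _, hJ, F, c, hc, eA, eB, hF, hlim, hf⟩ := hf
  have sq' : IsPushout (c.ι.app ⊥) (eA.inv ≫ u) (eB.hom ≫ w) f' :=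
    IsPushout.paste_vert (IsPushout.of_vert_isIso ⟨by simp [← hf]⟩) sq
  refine (isBoundedTransfiniteCompositionOf_of_isPushout hJ (arrowOfBot F)
    (isColimitConstCocone J (F.obj ⊥)) (cg := c) hc sq' (fun j => ?_) ?_ (fun j hj => ?_) hlim
    (fun j hj => ?_) ⊤ (fun _ _ _ _ _ => trivial)).mono fun _ _ _ h => h.1
  · exact (Category.id_comp _).trans (c.w _).symm
  · change IsIso (F.map (𝟙 ⊥))
    infer_instance
  · have : Nonempty {i : J // i < j} := ⟨⟨⊥, hj.bot_lt⟩⟩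
    exact ⟨isColimitConstCocone _ (F.obj ⊥)⟩
  · have sq₀ : IsPushout (F.map (homOfLE (bot_le : ⊥ ≤ j))) (𝟙 _) (𝟙 _) (F.map (homOfLE bot_le)) :=
      IsPushout.of_vert_isIso ⟨by simp⟩
    exact ⟨F.obj j, 𝟙 _, _, F.map (homOfLE (Order.le_succ j)), sq₀, Category.id_comp _,
      (F.map_comp _ _).symm, hF j hj⟩

/-- In a locally presentable category, a transfinite composite of pushouts of morphisms between
presentable objects is a pushout of a transfinite composite of such pushouts between presentable
objects. -/
lemma IsLocallyPresentable.po_isBoundedTransfiniteCompositionOf {κ : Cardinal.{v}}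
    (hK : IsLocallyPresentable κ K) {X : MorphismProperty K}
    (hX : ∀ ⦃A B : K⦄ (f : A ⟶ B), X f →
      IsCardinalPresentable κ A ∧ IsCardinalPresentable κ B)
    {A B : K} {f : A ⟶ B} (hf : IsBoundedTransfiniteCompositionOf κ (Po X) f) :
    Po (IsBoundedTransfiniteCompositionOf κ (PoCard κ X)) f := by
  obtain ⟨J, _, _, _, _, hJ, F, c, hc, eA, eB, hF, hlim, hf⟩ := hf
  have := hK.hasColimits
  obtain ⟨Γ, τ, h, hbot, hleft, hright, hcell⟩ :=
    hK.exists_isRelativeCell_chain hX hJ F hF hlim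
  let α := Functor.whiskerLeft Γ Arrow.leftToRight
  let ζ := Functor.whiskerRight τ Arrow.leftFunc
  let γ := Functor.whiskerRight τ Arrow.rightFunc
  let ca := colimit.cocone (Γ ⋙ Arrow.leftFunc)
  let cg := colimit.cocone (Γ ⋙ Arrow.rightFunc)
  let cz : Cocone (arrowOfBot F ⋙ Arrow.leftFunc) := constCocone J (F.obj ⊥)
  have hca : IsColimit ca := colimit.isColimit _
  have hcg : IsColimit cg := colimit.isColimit _
  have hcz : IsColimit cz := isColimitConstCocone J (F.obj ⊥)
  let a : ca.pt ⟶ cg.pt := hca.map cg α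
  have ha (j : J) : ca.ι.app j ≫ a = (Γ.obj j).hom ≫ cg.ι.app j := hca.ι_map cg α j
  have sq : IsPushout a (hca.map cz ζ) (hcg.map c γ) (c.ι.app ⊥) :=
    isPushout_of_isColimit (α := α) (ζ := ζ) (γ := γ)
      (η := Functor.whiskerLeft (arrowOfBot F) Arrow.leftToRight) (cz := cz) (ch := c)
      (fun j => (h j).2.2) hca hcg hcz hc ha (hca.ι_map cz ζ) (hcg.ι_map c γ)
      (fun j => (Category.id_comp _).trans (c.w _).symm)
  have hI := hasCardinalLT_arrow_of_preorder hK.regular hJ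
  have hpt : IsCardinalPresentable κ ca.pt := .of_isColimit hK.regular hI (fun j => (h j).1) hca
  have sq' : IsPushout (c.ι.app ⊥) eA.inv eB.hom f := IsPushout.of_vert_isIso ⟨by simp [← hf]⟩
  refine ⟨_, _, a, _, _, ?_, sq.paste_vert sq'⟩
  exact isBoundedTransfiniteCompositionOf_of_isPushout hJ Γ hca hcg (z := 𝟙 _) (g := 𝟙 _)
    (IsPushout.of_vert_isIso ⟨by simp⟩) ha hbot hleft hright hcell (IsCardinalPresentable κ)
    (fun j _ _ _ sq => .of_isPushout hK.regular sq (h j).1 (h j).2.1 hpt)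

/-- in a locally κ-presentable category with `X` a set of morphisms between
κ-presentable objects, `Tc_{<κ} Po(X) = Po Tc_{<κ} Po_κ(X)`. -/
theorem tc_po_eq_po_tc_po {K : Type u} [Category.{v} K]
    {κ : Cardinal.{v}} (hK : IsLocallyPresentable κ K)
    (X : MorphismProperty K)
    (hsmall : Small.{v} {f : Arrow K // X f.hom})
    (hX : ∀ ⦃A B : K⦄ (f : A ⟶ B), X f →
      IsCardinalPresentable κ A ∧ IsCardinalPresentable κ B) :
    ∀ {A B : K} (f : A ⟶ B),
      IsBoundedTransfiniteCompositionOf κ (Po X) f ↔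
        Po (IsBoundedTransfiniteCompositionOf κ (PoCard κ X)) f := by
  have := hK.hasColimits
  refine fun {_ _} f => ⟨hK.po_isBoundedTransfiniteCompositionOf hX, ?_⟩
  rintro ⟨_, _, _, _, _, hf, sq⟩
  exact (hf.mono fun _ _ _ h => h.1).of_isPushout sq

end CellularPaper
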